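/- For m ≥ 2, the number of square occurrences (counted with multiplicity of occurrence) in the prefix of length f_m of the Fibonacci word is B(f_m) = (4m−16)/5 · f_m − (2m−6)/5 · f_{m−1} + m + 2. -/

import Mathlib

/-- Finite Fibonacci words: `fibF 0 = a`, `fibF 1 = ab`,
`fibF (m+2) = fibF (m+1) ++ fibF m`, with letters `a = false`, `b = true`.
Each `fibF m` is a prefix of the next, so a word is a factor of the infinite
Fibonacci word `𝔽` iff it is a factor (infix) of some `fibF m`. -/
def fibF : ℕ → List Bool
  | 0 => [false]
  | 1 => [false, true]
  | n + 2 => fibF (n + 1) ++ fibF n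

/-- A word is a factor of the infinite Fibonacci word. -/
def IsFactorF (w : List Bool) : Prop := ∃ m, w <:+: fibF m

/-- The prefix `𝔽[1,n]` of the infinite Fibonacci word of length `n`
(`fibF n` has length `fib (n+2) ≥ n`). -/
def fibPrefix (n : ℕ) : List Bool := (fibF n).take n

/-- `B n`: the number of occurrences of squares in `𝔽[1,n]`, i.e. the number of
pairs `(w, i)` with `w ≠ []` such that `ww` occurs in `𝔽[1,n]` starting at
(0-indexed) position `i`. -/
noncomputable def B (n : ℕ) : ℕ :=
  Set.ncard {q : List Bool × ℕ |
    q.1 ≠ [] ∧ (q.1 ++ q.1) <+: (fibPrefix n).drop q.2}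

/-- `D n`: the number of occurrences of cubes in `𝔽[1,n]`. -/
noncomputable def D (n : ℕ) : ℕ :=
  Set.ncard {q : List Bool × ℕ |
    q.1 ≠ [] ∧ (q.1 ++ q.1 ++ q.1) <+: (fibPrefix n).drop q.2}

open Finset

theorem length_fibF : ∀ m, (fibF m).length = Nat.fib (m + 2)
  | 0 => rfl
  | 1 => rfl
  | m + 2 => by
    rw [fibF, List.length_append, length_fibF (m + 1), length_fibF m, add_comm]
    exact Nat.fib_add_two.symm

theorem fibF_prefix_succ : ∀ m, fibF m <+: fibF (m + 1)
  | 0 => ⟨[true], rfl⟩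
  | _ + 1 => List.prefix_append _ _

theorem fibF_prefix_of_le {m n : ℕ} (h : m ≤ n) : fibF m <+: fibF n := by
  induction n, h using Nat.le_induction with
  | base => exact List.prefix_rfl
  | succ n _ ih => exact ih.trans (fibF_prefix_succ n)

theorem lt_fib_add_two (n : ℕ) : n < Nat.fib (n + 2) := by
  have := Nat.le_fib_add_one (n + 2)
  omega

/-- The infinite Fibonacci word, with letters `a = false`, `b = true`. -/
def fibWord (n : ℕ) : Bool := (fibF n).getD n false

theorem getElem?_fibF {m j : ℕ} (h : j < Nat.fib (m + 2)) : (fibF m)[j]? = some (fibWord j) := by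
  have hj : (fibF j)[j]? = some (fibWord j) := by
    have : j < (fibF j).length := by rw [length_fibF]; exact lt_fib_add_two j
    simp [fibWord, this]
  rcases le_total m j with hmj | hmj
  · rw [← hj]
    have h' : j < (fibF m).length := by rwa [length_fibF]
    rw [List.prefix_iff_getElem?.1 (fibF_prefix_of_le hmj) j h']
    simp [h']
  · have h' : j < (fibF j).length := by rw [length_fibF]; exact lt_fib_add_two j
    have := List.prefix_iff_getElem?.1 (fibF_prefix_of_le hmj) j h'
    rw [this, ← hj]
    simp [h']

theorem fibWord_add_fib_of_lt {m j : ℕ} (h : j < Nat.fib (m + 2)) :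
    fibWord (j + Nat.fib (m + 3)) = fibWord j := by
  have h1 : (fibF (m + 2))[j + Nat.fib (m + 3)]? = some (fibWord (j + Nat.fib (m + 3))) := by
    have h4 : Nat.fib (m + 2 + 2) = Nat.fib (m + 2) + Nat.fib (m + 3) := Nat.fib_add_two
    exact getElem?_fibF (by omega)
  have hlen : (fibF (m + 1)).length = Nat.fib (m + 3) := length_fibF (m + 1)
  rw [fibF, List.getElem?_append_right (by omega), hlen, Nat.add_sub_cancel,
    getElem?_fibF h] at h1
  exact (Option.some.inj h1).symm

theorem fibWord_add_fib_eq_iff (m : ℕ) : ∀ j < Nat.fib (m + 3),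
    fibWord (j + Nat.fib (m + 2)) = fibWord j ↔ j + 2 < Nat.fib (m + 3) := by
  induction m with
  | zero =>
    intro j hj
    change j < 2 at hj
    interval_cases j <;> simp [fibWord, fibF, Nat.fib_add_two]
  | succ m ih =>
    intro j hj
    have h4 : Nat.fib (m + 1 + 3) = Nat.fib (m + 2) + Nat.fib (m + 3) := Nat.fib_add_two
    have e3 : Nat.fib (m + 1 + 2) = Nat.fib (m + 3) := rfl
    rw [h4] at hj ⊢
    rw [e3]
    have hpos : 2 ≤ Nat.fib (m + 3) := Nat.fib_mono (show 3 ≤ m + 3 by omega)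
    rcases lt_or_ge j (Nat.fib (m + 2)) with h | h
    · simp only [fibWord_add_fib_of_lt h, true_iff]
      omega
    · obtain ⟨t, rfl⟩ := Nat.exists_eq_add_of_le' h
      have : fibWord (t + Nat.fib (m + 2) + Nat.fib (m + 3)) = fibWord t := by
        rw [add_assoc, ← h4]
        exact fibWord_add_fib_of_lt (m := m + 1) (by rw [e3]; omega)
      rw [this, eq_comm, ih t (by omega)]
      omega

/-- The Fibonacci substitution `a ↦ ab`, `b ↦ a`. -/
def fibSubst : Bool → List Bool
  | false => [false, true]
  | true => [false]

theorem fibF_succ_eq_flatMap : ∀ m,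
    fibF (m + 1) = (fibF m).flatMap fibSubst
  | 0 => rfl
  | 1 => rfl
  | m + 2 => by
    change fibF (m + 2) ++ fibF (m + 1) = (fibF (m + 1) ++ fibF m).flatMap fibSubst
    rw [fibF_succ_eq_flatMap (m + 1), fibF_succ_eq_flatMap m, List.flatMap_append]

/-- The number of letters `a` among the first `n` letters of the infinite Fibonacci word. -/
def countA : ℕ → ℕ
  | 0 => 0
  | n + 1 => countA n + bif fibWord n then 0 else 1

theorem length_flatMap_take_fibF {m n : ℕ} (h : n ≤ Nat.fib (m + 2)) :
    (((fibF m).take n).flatMap fibSubst).length =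
      n + countA n := by
  induction n with
  | zero => simp [countA]
  | succ n ih =>
    rw [List.take_add_one, List.flatMap_append, List.length_append, ih (by omega),
      getElem?_fibF (by omega), countA]
    cases fibWord n <;> simp [fibSubst] <;> omega

theorem getElem?_flatMap_fibSubst {l : List Bool} {n : ℕ} {c : Bool} (h : l[n]? = some c) (t : ℕ)
    (ht : t < (fibSubst c).length) :
    (l.flatMap fibSubst)[
      ((l.take n).flatMap fibSubst).length + t]? =
    (fibSubst c)[t]? := by
  have hn : n < l.length := (List.getElem?_eq_some_iff.1 h).1
  have hl : l = l.take n ++ c :: l.drop (n + 1) := by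
    have := (List.getElem?_eq_some_iff.1 h).2
    rw [← this, List.getElem_cons_drop, List.take_append_drop]
  conv_lhs => lhs; rw [hl]
  rw [List.flatMap_append, List.getElem?_append_right (by omega), Nat.add_sub_cancel_left,
    List.flatMap_cons, List.getElem?_append_left ht]

theorem getElem?_fibSubst_fibWord (n t : ℕ) (ht : t < (fibSubst (fibWord n)).length) :
    (fibSubst (fibWord n))[t]? = some (fibWord (n + countA n + t)) := by
  rw [← getElem?_flatMap_fibSubst (getElem?_fibF (lt_fib_add_two n)) t ht,
    length_flatMap_take_fibF (lt_fib_add_two n).le, ← fibF_succ_eq_flatMap]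
  apply getElem?_fibF
  rw [← length_fibF, fibF_succ_eq_flatMap, ← length_flatMap_take_fibF (lt_fib_add_two n).le]
  have h := getElem?_flatMap_fibSubst (getElem?_fibF (lt_fib_add_two n)) t ht
  rw [List.getElem?_eq_getElem ht] at h
  exact (List.getElem?_eq_some_iff.1 h).1

theorem fibWord_add_countA (n : ℕ) : fibWord (n + countA n) = false := by
  have := getElem?_fibSubst_fibWord n 0 (by cases fibWord n <;> simp [fibSubst])
  revert this
  cases fibWord n <;> simp [fibSubst]

theorem fibWord_add_countA_add_one {n : ℕ} (h : fibWord n = false) :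
    fibWord (n + countA n + 1) = true := by
  have := getElem?_fibSubst_fibWord n 1 (by simp [h, fibSubst])
  revert this
  simp [h, fibSubst]

theorem countA_succ_of_false {n : ℕ} (h : fibWord n = false) : countA (n + 1) = countA n + 1 := by
  simp [countA, h]

theorem countA_succ_of_true {n : ℕ} (h : fibWord n = true) : countA (n + 1) = countA n := by
  simp [countA, h]

theorem exists_eq_add_countA (j : ℕ) :
    ∃ n, j = n + countA n ∨ (j = n + countA n + 1 ∧ fibWord n = false) := by
  induction j with
  | zero => exact ⟨0, Or.inl rfl⟩
  | succ j ih =>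
    obtain ⟨n, rfl | ⟨rfl, h⟩⟩ := ih
    · cases h : fibWord n
      · exact ⟨n, Or.inr ⟨rfl, h⟩⟩
      · exact ⟨n + 1, Or.inl (by rw [countA_succ_of_true h]; omega)⟩
    · exact ⟨n + 1, Or.inl (by rw [countA_succ_of_false h]; omega)⟩

theorem exists_of_fibWord_eq_false {j : ℕ} (h : fibWord j = false) : ∃ n, j = n + countA n := by
  obtain ⟨n, rfl | ⟨rfl, hn⟩⟩ := exists_eq_add_countA j
  · exact ⟨n, rfl⟩
  · rw [fibWord_add_countA_add_one hn] at h
    cases h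

theorem exists_of_fibWord_eq_true {j : ℕ} (h : fibWord j = true) :
    ∃ n, j = n + countA n + 1 ∧ fibWord n = false := by
  obtain ⟨n, rfl | hn⟩ := exists_eq_add_countA j
  · rw [fibWord_add_countA] at h
    cases h
  · exact ⟨n, hn⟩

theorem fibWord_succ_eq_false {j : ℕ} (h : fibWord j = true) : fibWord (j + 1) = false := by
  obtain ⟨n, rfl, hn⟩ := exists_of_fibWord_eq_true h
  have := fibWord_add_countA (n + 1)
  rw [countA_succ_of_false hn] at this
  convert this using 2
  omega

theorem countA_mono : Monotone countA := monotone_nat_of_le_succ fun _ => Nat.le_add_right _ _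

theorem countA_add_countA (n : ℕ) : countA (n + countA n) = n := by
  induction n with
  | zero => rfl
  | succ n ih =>
    have h1 := countA_succ_of_false (fibWord_add_countA n)
    cases h : fibWord n
    · rw [countA_succ_of_false h, show n + 1 + (countA n + 1) = n + countA n + 1 + 1 by ring,
        countA_succ_of_true (fibWord_add_countA_add_one h), h1, ih]
    · rw [countA_succ_of_true h, show n + 1 + countA n = n + countA n + 1 by ring, h1, ih]

/-- If `fibWord` agrees with its translate by `|σ(u)|` on all but the last letter of a window of
that length, then it agrees with its translate by `|u|` on all but the last letter of the
corresponding preimage window. -/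
theorem match_of_subst_match {n q p : ℕ} (hp : n + countA n + p = n + q + countA (n + q))
    (h : ∀ j, j + 1 < p → fibWord (n + countA n + j) = fibWord (n + countA n + p + j)) :
    ∀ j, j + 1 < q → fibWord (n + j) = fibWord (n + q + j) := by
  have hwin : ∀ s, n + countA n ≤ s → s + 1 < n + countA n + p → fibWord s = fibWord (s + p) := by
    intro s hs hs'
    obtain ⟨j, rfl⟩ := Nat.exists_eq_add_of_le hs
    rw [h j (by omega), add_right_comm]
  have step : ∀ j, j + 1 < q → n + j + countA (n + j) + p = n + q + j + countA (n + q + j) →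
      fibWord (n + j) = fibWord (n + q + j) := by
    intro j hj hpos
    have h0 := countA_mono (show n ≤ n + j by omega)
    have h1 := countA_mono (show n + j ≤ n + j + 1 by omega)
    have h2 := countA_mono (show n + j + 1 ≤ n + j + 1 + 1 by omega)
    have h3 := countA_mono (show n + j + 1 + 1 ≤ n + q by omega)
    have hw := hwin (n + j + countA (n + j) + 1) (by omega)
    rw [add_right_comm _ 1 p, hpos] at hw
    cases hx : fibWord (n + j) <;> cases hy : fibWord (n + q + j)
    · rfl
    · have hc := countA_succ_of_false hx
      have hf := fibWord_add_countA (n + q + j + 1)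
      rw [countA_succ_of_true hy, add_right_comm _ 1] at hf
      rw [fibWord_add_countA_add_one hx, hf] at hw
      exact (hw (by omega)).symm
    · have hc := countA_succ_of_false (fibWord_succ_eq_false hx)
      have hf := fibWord_add_countA (n + j + 1)
      rw [countA_succ_of_true hx, add_right_comm _ 1] at hf
      rw [fibWord_add_countA_add_one hy, hf] at hw
      exact (hw (by omega)).symm
    · rfl
  have pos : ∀ j, j + 1 ≤ q → n + j + countA (n + j) + p = n + q + j + countA (n + q + j) := by
    intro j
    induction j with
    | zero => exact fun _ => by simpa using hp
    | succ j ih =>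
      intro hj
      have hm := step j hj (ih (by omega))
      have := ih (by omega)
      rw [← add_assoc, ← add_assoc, countA, countA, hm]
      omega
  exact fun j hj => step j hj (pos j hj.le)

/-- A window of length `p` in which the translate by `p` agrees except possibly at the last letter
has Fibonacci length. -/
theorem exists_fib_of_match (p : ℕ) : ∀ i, 0 < p →
    (∀ j, j + 1 < p → fibWord (i + j) = fibWord (i + p + j)) →
    ∃ k, p = Nat.fib (k + 1) ∧ countA (i + p) = countA i + Nat.fib k := by
  induction p using Nat.strong_induction_on with
  | _ p ih =>
    intro i hp h
    rcases Nat.lt_or_ge 1 p with hp1 | hp1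
    · have main : ∀ i, fibWord i = false →
          (∀ j, j + 1 < p → fibWord (i + j) = fibWord (i + p + j)) →
          ∃ k, p = Nat.fib (k + 1) ∧ countA (i + p) = countA i + Nat.fib k := by
        intro i hi h
        obtain ⟨n, rfl⟩ := exists_of_fibWord_eq_false hi
        have hi' := h 0 (by omega)
        simp only [add_zero, hi] at hi'
        obtain ⟨n', hn'⟩ := exists_of_fibWord_eq_false hi'.symm
        have hnn : n < n' := by
          by_contra! hc
          have := countA_mono hc
          omega
        obtain ⟨q, rfl⟩ := Nat.exists_eq_add_of_le hnn.le
        have hmono := countA_mono (show n ≤ n + q by omega)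
        have hqp : q < p := by
          by_contra! hc
          have hq : q = p := by omega
          have h0 := countA_mono (show n ≤ n + 1 by omega)
          have h1 := countA_mono (show n + 1 ≤ n + 1 + 1 by omega)
          have h2 := countA_mono (show n + 1 + 1 ≤ n + q by omega)
          cases hx : fibWord n
          · have := countA_succ_of_false hx
            omega
          · have := countA_succ_of_false (fibWord_succ_eq_false hx)
            omega
        obtain ⟨k, hk, hk'⟩ := ih q hqp n (by omega) (match_of_subst_match hn' h)
        refine ⟨k + 1, ?_, ?_⟩
        · rw [Nat.fib_add_two]
          omega
        · rw [hn', countA_add_countA, countA_add_countA, ← hk]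
      cases hi : fibWord i
      · exact main i hi h
      · have hi' := h 0 (by omega)
        simp only [add_zero, hi] at hi'
        obtain ⟨n, rfl, hn⟩ := exists_of_fibWord_eq_true hi
        obtain ⟨n', hn', hn''⟩ := exists_of_fibWord_eq_true hi'.symm
        have hs : n + countA n + p = n' + countA n' := by omega
        have h0 := fibWord_add_countA n
        have h0' := fibWord_add_countA n'
        obtain ⟨k, hk, hk'⟩ := main (n + countA n) h0 (by
          rintro (_ | j) hj
          · rw [add_zero, add_zero, hs, h0, h0']
          · have := h j (by omega)
            convert this using 2 <;> omega)
        refine ⟨k, hk, ?_⟩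
        rw [hn', countA_succ_of_false h0, countA_succ_of_false h0', ← hs]
        omega
    · obtain rfl : p = 1 := by omega
      cases hi : fibWord i
      · exact ⟨1, rfl, countA_succ_of_false hi⟩
      · exact ⟨0, rfl, countA_succ_of_true hi⟩

/-- A square of period `fib (k + 2)` starts at position `i` of the infinite Fibonacci word. -/
def IsSquareAt (k i : ℕ) : Prop :=
  ∀ j < Nat.fib (k + 2), fibWord (i + j) = fibWord (i + j + Nat.fib (k + 2))

instance (k i : ℕ) : Decidable (IsSquareAt k i) := by
  unfold IsSquareAt
  infer_instance

theorem isSquareAt_of_lt {k i : ℕ} (h : i < Nat.fib (k + 3)) :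
    IsSquareAt k i ↔ i + 2 ≤ Nat.fib (k + 1) := by
  have h3 : Nat.fib (k + 3) = Nat.fib (k + 1) + Nat.fib (k + 2) := Nat.fib_add_two
  have hpos : 0 < Nat.fib (k + 2) := Nat.fib_pos.2 (by omega)
  have hpos' : 0 < Nat.fib (k + 1) := Nat.fib_pos.2 (by omega)
  constructor
  · intro hs
    by_contra! hc
    have key : ∀ j, i ≤ j → j < i + Nat.fib (k + 2) → j < Nat.fib (k + 3) →
        j + 2 < Nat.fib (k + 3) := by
      intro j hj hj' hj3
      obtain ⟨t, rfl⟩ := Nat.exists_eq_add_of_le hj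
      exact (fibWord_add_fib_eq_iff k _ hj3).1 (hs t (by omega)).symm
    have hi := key i le_rfl (by omega) h
    have := key (Nat.fib (k + 3) - 2) (by omega) (by omega) (by omega)
    omega
  · intro hi j hj
    exact ((fibWord_add_fib_eq_iff k (i + j) (by omega)).2 (by omega)).symm

theorem isSquareAt_of_le_of_lt {k i : ℕ} (h : Nat.fib (k + 3) ≤ i) (h' : i < Nat.fib (k + 4)) :
    IsSquareAt k i := by
  intro j hj
  have h3 : Nat.fib (k + 3) = Nat.fib (k + 1) + Nat.fib (k + 2) := Nat.fib_add_two
  have h4 : Nat.fib (k + 4) = Nat.fib (k + 2) + Nat.fib (k + 3) := Nat.fib_add_two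
  have h5 : Nat.fib (k + 5) = Nat.fib (k + 3) + Nat.fib (k + 4) := Nat.fib_add_two
  have hpos : 0 < Nat.fib (k + 1) := Nat.fib_pos.2 (by omega)
  obtain ⟨t, rfl⟩ := Nat.exists_eq_add_of_le' h
  have e1 := (fibWord_add_fib_eq_iff (k + 1) (t + j) (by
    change _ < Nat.fib (k + 4); omega)).2 (by change _ < Nat.fib (k + 4); omega)
  have e2 := (fibWord_add_fib_eq_iff (k + 2) (t + j) (by
    change _ < Nat.fib (k + 5); omega)).2 (by change _ < Nat.fib (k + 5); omega)
  change fibWord (t + j + Nat.fib (k + 3)) = _ at e1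
  change fibWord (t + j + Nat.fib (k + 4)) = _ at e2
  rw [add_right_comm t, e1, ← e2, h4]
  congr 1
  omega

theorem two_mul_fib_lt {k m : ℕ} (h : k < m) : 2 * Nat.fib (k + 2) < Nat.fib (m + 3) := by
  have h3 : Nat.fib (k + 3) = Nat.fib (k + 1) + Nat.fib (k + 2) := Nat.fib_add_two
  have h4 : Nat.fib (k + 4) = Nat.fib (k + 2) + Nat.fib (k + 3) := Nat.fib_add_two
  have hpos : 0 < Nat.fib (k + 1) := Nat.fib_pos.2 (by omega)
  have := Nat.fib_mono (show k + 4 ≤ m + 3 by omega)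
  omega

theorem isSquareAt_add_fib_iff {k m i : ℕ} (hk : k < m) (hi : i < Nat.fib (m + 2)) :
    IsSquareAt k (Nat.fib (m + 3) + i) ↔ IsSquareAt k i := by
  have h4 : Nat.fib (m + 4) = Nat.fib (m + 2) + Nat.fib (m + 3) := Nat.fib_add_two
  have h2 := two_mul_fib_lt hk
  have key : ∀ j < i + 2 * Nat.fib (k + 2), fibWord (Nat.fib (m + 3) + j) = fibWord j := by
    intro j hj
    rw [add_comm]
    exact (fibWord_add_fib_eq_iff (m + 1) j (by change _ < Nat.fib (m + 4); omega)).2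
      (by change _ < Nat.fib (m + 4); omega)
  refine forall₂_congr fun j hj => ?_
  rw [add_assoc, add_assoc, key _ (by omega), key _ (by omega)]

/-- The number of squares of period `fib (k + 2)` starting in the prefix of length `fib (m + 2)`. -/
def squareStarts (k m : ℕ) : ℕ := Nat.count (IsSquareAt k) (Nat.fib (m + 2))

theorem squareStarts_add_one (k : ℕ) : squareStarts k (k + 1) = Nat.fib (k + 1) - 1 := by
  have h3 : Nat.fib (k + 3) = Nat.fib (k + 1) + Nat.fib (k + 2) := Nat.fib_add_two
  have hpos : 0 < Nat.fib (k + 2) := Nat.fib_pos.2 (by omega)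
  rw [squareStarts, Nat.count_eq_card_filter_range, ← card_range (Nat.fib (k + 1) - 1)]
  congr 1
  ext i
  simp only [mem_filter, mem_range]
  change i < Nat.fib (k + 3) ∧ _ ↔ _
  constructor
  · rintro ⟨hi, hs⟩
    have := (isSquareAt_of_lt hi).1 hs
    omega
  · intro hi
    exact ⟨by omega, (isSquareAt_of_lt (by omega)).2 (by omega)⟩

theorem squareStarts_add_two (k : ℕ) :
    squareStarts k (k + 2) = Nat.fib (k + 1) - 1 + Nat.fib (k + 2) := by
  rw [← squareStarts_add_one, squareStarts, squareStarts]
  have h4 : Nat.fib (k + 2 + 2) = Nat.fib (k + 1 + 2) + Nat.fib (k + 2) := by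
    exact Nat.fib_add_two.trans (add_comm _ _)
  rw [h4, Nat.count_add, Nat.add_left_cancel_iff, Nat.count_iff_forall]
  intro i hi
  exact isSquareAt_of_le_of_lt (Nat.le_add_right _ _) (by
    change _ < Nat.fib (k + 2 + 2); rw [h4]; exact Nat.add_lt_add_left hi _)

theorem squareStarts_succ_succ {k m : ℕ} (hk : k < m) :
    squareStarts k (m + 2) = squareStarts k (m + 1) + squareStarts k m := by
  have h4 : Nat.fib (m + 2 + 2) = Nat.fib (m + 1 + 2) + Nat.fib (m + 2) := by
    exact Nat.fib_add_two.trans (add_comm _ _)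
  rw [squareStarts, squareStarts, squareStarts, h4, Nat.count_add, Nat.add_left_cancel_iff,
    Nat.count_eq_card_filter_range, Nat.count_eq_card_filter_range]
  congr 1
  exact filter_congr fun i hi => isSquareAt_add_fib_iff hk (mem_range.1 hi)

/-- The number of squares of period `fib (k + 2)` in the prefix of length `fib (m + 2)`. -/
def squareCount (k m : ℕ) : ℕ :=
  Nat.count (fun i => IsSquareAt k i ∧ i + 2 * Nat.fib (k + 2) ≤ Nat.fib (m + 2)) (Nat.fib (m + 2))

theorem squareCount_add_two (k : ℕ) : squareCount k (k + 2) = Nat.fib (k + 1) - 1 := by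
  have h3 : Nat.fib (k + 3) = Nat.fib (k + 1) + Nat.fib (k + 2) := Nat.fib_add_two
  have h4 : Nat.fib (k + 2 + 2) = Nat.fib (k + 2) + Nat.fib (k + 3) := Nat.fib_add_two
  have hpos : 0 < Nat.fib (k + 2) := Nat.fib_pos.2 (by omega)
  rw [squareCount, Nat.count_eq_card_filter_range, ← card_range (Nat.fib (k + 1) - 1)]
  congr 1
  ext i
  simp only [mem_filter, mem_range]
  constructor
  · rintro ⟨hi, hs, hle⟩
    have := (isSquareAt_of_lt (by omega)).1 hs
    omega
  · intro hi
    exact ⟨by omega, (isSquareAt_of_lt (by omega)).2 (by omega), by omega⟩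

theorem squareCount_succ_add_three (k : ℕ) :
    squareCount (k + 1) (k + 4) = 2 * Nat.fib (k + 2) := by
  have h3 : Nat.fib (k + 3) = Nat.fib (k + 1) + Nat.fib (k + 2) := Nat.fib_add_two
  have h4 : Nat.fib (k + 4) = Nat.fib (k + 2) + Nat.fib (k + 3) := Nat.fib_add_two
  have h5 : Nat.fib (k + 5) = Nat.fib (k + 3) + Nat.fib (k + 4) := Nat.fib_add_two
  have h6 : Nat.fib (k + 4 + 2) = Nat.fib (k + 4) + Nat.fib (k + 5) := Nat.fib_add_two
  have hpos : 0 < Nat.fib (k + 1) := Nat.fib_pos.2 (by omega)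
  have hpos' : 0 < Nat.fib (k + 2) := Nat.fib_pos.2 (by omega)
  have e3 : Nat.fib (k + 1 + 2) = Nat.fib (k + 3) := rfl
  have hcard : 2 * Nat.fib (k + 2) = (range (Nat.fib (k + 2) - 1) ∪
      Ico (Nat.fib (k + 4)) (Nat.fib (k + 4) + Nat.fib (k + 2) + 1)).card := by
    rw [card_union_of_disjoint, card_range, Nat.card_Ico]
    · omega
    · rw [disjoint_left]
      intro i
      simp only [mem_range, mem_Ico]
      omega
  rw [squareCount, Nat.count_eq_card_filter_range, hcard]
  congr 1
  ext i
  simp only [mem_filter, mem_range, mem_union, mem_Ico, e3]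
  constructor
  · rintro ⟨hi, hs, hle⟩
    rcases lt_or_ge i (Nat.fib (k + 4)) with h | h
    · have : i + 2 ≤ Nat.fib (k + 2) := (isSquareAt_of_lt (k := k + 1) h).1 hs
      omega
    · omega
  · rintro (hi | hi)
    · refine ⟨by omega, (isSquareAt_of_lt (k := k + 1) ?_).2 ?_, by omega⟩
      · change i < Nat.fib (k + 4); omega
      · change i + 2 ≤ Nat.fib (k + 2); omega
    · refine ⟨by omega, isSquareAt_of_le_of_lt (k := k + 1) hi.1 ?_, by omega⟩
      change i < Nat.fib (k + 5); omega

theorem squareCount_succ_succ {k m : ℕ} (hk : k + 2 ≤ m) :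
    squareCount k (m + 2) = squareStarts k (m + 1) + squareCount k m := by
  have h4 : Nat.fib (m + 2 + 2) = Nat.fib (m + 1 + 2) + Nat.fib (m + 2) := by
    exact Nat.fib_add_two.trans (add_comm _ _)
  obtain ⟨n, rfl⟩ : ∃ n, m = n + 1 := ⟨m - 1, by omega⟩
  have h2 : 2 * Nat.fib (k + 2) < Nat.fib (n + 1 + 2) := two_mul_fib_lt (m := n) (by omega)
  rw [squareCount, squareStarts, squareCount]
  simp only [h4, Nat.count_add]
  simp only [Nat.count_eq_card_filter_range]
  congr 2
  · refine filter_congr fun i hi => ?_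
    have := mem_range.1 hi
    exact and_iff_left (by omega)
  · refine filter_congr fun i hi => ?_
    have := mem_range.1 hi
    exact and_congr (isSquareAt_add_fib_iff (by omega) this) (by omega)

theorem fibPrefix_fib {m : ℕ} (hm : m ≤ Nat.fib (m + 2)) : fibPrefix (Nat.fib (m + 2)) = fibF m := by
  rw [fibPrefix, ← length_fibF m]
  exact (List.prefix_iff_eq_take.1 (fibF_prefix_of_le (by rwa [length_fibF]))).symm

theorem append_self_prefix_drop_fibF_iff {m i : ℕ} {w : List Bool} (hw : w ≠ []) :
    w ++ w <+: (fibF m).drop i ↔ i + 2 * w.length ≤ Nat.fib (m + 2) ∧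
      (∀ j < w.length, fibWord (i + j) = fibWord (i + j + w.length)) ∧
      w = ((fibF m).drop i).take w.length := by
  have hlen := length_fibF m
  have hpos := List.length_pos_iff.2 hw
  constructor
  · intro h
    have hle : i + 2 * w.length ≤ Nat.fib (m + 2) := by
      have := h.length_le
      rw [List.length_append, List.length_drop, hlen] at this
      omega
    refine ⟨hle, fun j hj => ?_, List.prefix_iff_eq_take.1 ((List.prefix_append w w).trans h)⟩
    have h1 := List.prefix_iff_getElem?.1 h j (by simp; omega)
    have h2 := List.prefix_iff_getElem?.1 h (j + w.length) (by simp; omega)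
    rw [List.getElem?_drop, getElem?_fibF (by omega), List.getElem_append_left hj] at h1
    rw [List.getElem?_drop, getElem?_fibF (by omega),
      List.getElem_append_right (Nat.le_add_left _ _)] at h2
    simp only [Nat.add_sub_cancel, Option.some.injEq] at h1 h2
    rw [h1, add_assoc, h2]
  · rintro ⟨hle, hs, hw⟩
    have hget : ∀ j (hj : j < w.length), w[j] = fibWord (i + j) := by
      intro j hj
      have h1 : w[j]? = some (fibWord (i + j)) := by
        rw [hw, List.getElem?_take_of_lt hj, List.getElem?_drop, getElem?_fibF (by omega)]
      exact (List.getElem?_eq_some_iff.1 h1).2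
    rw [List.prefix_iff_getElem?]
    intro j hj
    have hj' := hj
    rw [List.length_append] at hj'
    rw [List.getElem?_drop, getElem?_fibF (by omega)]
    rcases lt_or_ge j w.length with h | h
    · rw [List.getElem_append_left h, hget]
    · rw [List.getElem_append_right h, hget, hs (j - w.length) (by omega),
        show i + (j - w.length) + w.length = i + j by omega]

theorem exists_eq_fib_of_square {p i : ℕ} (hp : 0 < p)
    (h : ∀ j < p, fibWord (i + j) = fibWord (i + j + p)) : ∃ k, p = Nat.fib (k + 2) := by
  obtain ⟨k, hk, -⟩ := exists_fib_of_match p i hp fun j hj => by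
    rw [h j (by omega), add_right_comm]
  cases k with
  | zero => exact ⟨0, hk⟩
  | succ k => exact ⟨k, hk⟩

theorem B_fib (n : ℕ) :
    B (Nat.fib (n + 4)) = ∑ k ∈ range (n + 1), squareCount k (n + 2) := by
  have hn : n + 2 ≤ Nat.fib (n + 2 + 2) := (lt_fib_add_two _).le
  let s : Finset (Σ _ : ℕ, ℕ) := (range (n + 1)).sigma fun k =>
    {i ∈ range (Nat.fib (n + 2 + 2)) |
      IsSquareAt k i ∧ i + 2 * Nat.fib (k + 2) ≤ Nat.fib (n + 2 + 2)}
  let f : (Σ _ : ℕ, ℕ) → List Bool × ℕ := fun x =>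
    (((fibF (n + 2)).drop x.2).take (Nat.fib (x.1 + 2)), x.2)
  have hlen : ∀ x ∈ s, (f x).1.length = Nat.fib (x.1 + 2) := by
    intro x hx
    simp only [s, mem_sigma, mem_filter, mem_range] at hx
    simp only [f, List.length_take, List.length_drop, length_fibF]
    omega
  have hinj : Set.InjOn f s := by
    rintro ⟨k, i⟩ hx ⟨k', i'⟩ hy h
    obtain rfl : i = i' := congrArg Prod.snd h
    have h1 : Nat.fib (k + 2) = Nat.fib (k' + 2) := by
      rw [← hlen _ hx, ← hlen _ hy, h]
    obtain rfl : k = k' := Nat.fib_add_two_strictMono.injective h1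
    rfl
  have hset : {q : List Bool × ℕ | q.1 ≠ [] ∧
      (q.1 ++ q.1) <+: (fibPrefix (Nat.fib (n + 4))).drop q.2} = (s.image f : Finset _) := by
    rw [show fibPrefix (Nat.fib (n + 4)) = fibF (n + 2) from fibPrefix_fib hn]
    ext ⟨w, i⟩
    simp only [Set.mem_ofPred_eq, coe_image, Set.mem_image, mem_coe]
    constructor
    · rintro ⟨hw, h⟩
      obtain ⟨hle, hs, hw'⟩ := (append_self_prefix_drop_fibF_iff hw).1 h
      have hpos := List.length_pos_iff.2 hw
      obtain ⟨k, hk⟩ := exists_eq_fib_of_square hpos hs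
      rw [hk] at hle hs hw' hpos
      refine ⟨⟨k, i⟩, ?_, Prod.ext hw'.symm rfl⟩
      simp only [s, mem_sigma, mem_filter, mem_range]
      refine ⟨?_, by omega, hs, hle⟩
      by_contra! hc
      have h1 := Nat.fib_mono (show n + 3 ≤ k + 2 by omega)
      have h2 := Nat.fib_mono (show n + 2 ≤ n + 3 by omega)
      have h4 : Nat.fib (n + 2 + 2) = Nat.fib (n + 2) + Nat.fib (n + 3) := Nat.fib_add_two
      have h3 : Nat.fib (n + 3) = Nat.fib (n + 1) + Nat.fib (n + 2) := Nat.fib_add_two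
      have h0 : 0 < Nat.fib (n + 1) := Nat.fib_pos.2 (by omega)
      omega
    · rintro ⟨⟨k, j⟩, hx, hf⟩
      obtain rfl : j = i := congrArg Prod.snd hf
      have hl := hlen _ hx
      rw [hf] at hl
      change w.length = Nat.fib (k + 2) at hl
      have hpos : 0 < Nat.fib (k + 2) := Nat.fib_pos.2 (by omega)
      have hw : w ≠ [] := List.length_pos_iff.1 (by omega)
      simp only [s, mem_sigma, mem_filter, mem_range] at hx
      refine ⟨hw, (append_self_prefix_drop_fibF_iff hw).2 ?_⟩
      rw [hl]
      exact ⟨hx.2.2.2, hx.2.2.1, (congrArg Prod.fst hf).symm⟩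
  rw [B, hset, Set.ncard_coe_finset, card_image_of_injOn hinj, card_sigma]
  simp only [squareCount, Nat.count_eq_card_filter_range]

theorem cast_squareStarts_add_one (k : ℕ) :
    (squareStarts k (k + 1) : ℚ) = Nat.fib (k + 1) - 1 := by
  rw [squareStarts_add_one, Nat.cast_sub (Nat.fib_pos.2 (by omega)), Nat.cast_one]

theorem cast_squareStarts_add_two (k : ℕ) :
    (squareStarts k (k + 2) : ℚ) = Nat.fib (k + 1) - 1 + Nat.fib (k + 2) := by
  rw [squareStarts_add_two, Nat.cast_add, Nat.cast_sub (Nat.fib_pos.2 (by omega)), Nat.cast_one]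

theorem cast_squareStarts_add_three (k : ℕ) :
    (squareStarts k (k + 3) : ℚ) = 2 * (Nat.fib (k + 1) - 1) + Nat.fib (k + 2) := by
  rw [squareStarts_succ_succ (Nat.lt_succ_self k), Nat.cast_add, cast_squareStarts_add_one,
    cast_squareStarts_add_two]
  ring

theorem sum_squareStarts_succ_succ (n : ℕ) :
    (∑ k ∈ range (n + 3), squareStarts k (n + 5) : ℚ) =
      ∑ k ∈ range (n + 2), (squareStarts k (n + 4) : ℚ) +
        ∑ k ∈ range (n + 1), (squareStarts k (n + 3) : ℚ) +
        3 * Nat.fib (n + 3) + Nat.fib (n + 2) + Nat.fib (n + 4) - 3 := by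
  have h : ∀ k ∈ range (n + 2), (squareStarts k (n + 5) : ℚ) =
      squareStarts k (n + 4) + squareStarts k (n + 3) := by
    intro k hk
    rw [squareStarts_succ_succ (m := n + 3) (by have := mem_range.1 hk; omega), Nat.cast_add]
  rw [sum_range_succ, sum_congr rfl h, sum_add_distrib,
    sum_range_succ (fun k => (squareStarts k (n + 3) : ℚ)) (n + 1),
    cast_squareStarts_add_two (n + 1), cast_squareStarts_add_three (n + 2)]
  ring

theorem sum_squareStarts (n : ℕ) :
    (∑ k ∈ range (n + 1), squareStarts k (n + 3) : ℚ) =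
      (2 * n - 4) / 5 * Nat.fib (n + 2) + (6 * n - 3) / 5 * Nat.fib (n + 3) + 3 := by
  induction n using Nat.twoStepInduction with
  | zero =>
    have h := cast_squareStarts_add_three 0
    norm_num [Nat.fib_add_two] at h ⊢
    linarith
  | one =>
    have h := cast_squareStarts_add_three 1
    have h0 : squareStarts 0 4 = squareStarts 0 3 + squareStarts 0 2 :=
      squareStarts_succ_succ (by omega)
    have h1 := cast_squareStarts_add_three 0
    have h2 := cast_squareStarts_add_two 0
    rw [sum_range_succ, sum_range_one, h0]
    norm_num [Nat.fib_add_two] at h h1 h2 ⊢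
    rw [h, h1, h2]
    norm_num
  | more n ih1 ih2 =>
    have h4 : Nat.fib (n + 4) = Nat.fib (n + 2) + Nat.fib (n + 3) := Nat.fib_add_two
    have h5 : Nat.fib (n + 5) = Nat.fib (n + 3) + Nat.fib (n + 4) := Nat.fib_add_two
    change (∑ k ∈ range (n + 3), squareStarts k (n + 5) : ℚ) =
      (2 * ((n + 2 : ℕ) : ℚ) - 4) / 5 * Nat.fib (n + 4) +
        (6 * ((n + 2 : ℕ) : ℚ) - 3) / 5 * Nat.fib (n + 5) + 3
    change (∑ k ∈ range (n + 2), squareStarts k (n + 4) : ℚ) =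
      (2 * ((n + 1 : ℕ) : ℚ) - 4) / 5 * Nat.fib (n + 3) +
        (6 * ((n + 1 : ℕ) : ℚ) - 3) / 5 * Nat.fib (n + 4) + 3 at ih2
    rw [sum_squareStarts_succ_succ, ih1, ih2, h5, h4]
    push_cast
    ring

theorem sum_squareCount_succ_succ (n : ℕ) :
    (∑ k ∈ range (n + 3), squareCount k (n + 4) : ℚ) =
      ∑ k ∈ range (n + 1), (squareCount k (n + 2) : ℚ) +
        ∑ k ∈ range (n + 1), (squareStarts k (n + 3) : ℚ) +
        2 * Nat.fib (n + 2) + Nat.fib (n + 3) - 1 := by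
  have h : ∀ k ∈ range (n + 1), (squareCount k (n + 4) : ℚ) =
      squareStarts k (n + 3) + squareCount k (n + 2) := by
    intro k hk
    rw [squareCount_succ_succ (m := n + 2) (by have := mem_range.1 hk; omega), Nat.cast_add]
  rw [sum_range_succ, sum_range_succ, sum_congr rfl h, sum_add_distrib,
    squareCount_succ_add_three, squareCount_add_two, Nat.cast_sub (Nat.fib_pos.2 (by omega))]
  push_cast
  ring

theorem squareCount_zero_three : squareCount 0 3 = 1 := by
  have h : ∀ i, IsSquareAt 0 i ↔ fibWord i = fibWord (i + 1) := fun i => by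
    simp [IsSquareAt]
  simp [squareCount, h, Nat.fib_add_two, Nat.count_succ, fibWord, fibF]

theorem sum_squareCount (n : ℕ) :
    (∑ k ∈ range (n + 1), squareCount k (n + 2) : ℚ) =
      (4 * n - 8) / 5 * Nat.fib (n + 4) - (2 * n - 2) / 5 * Nat.fib (n + 3) + n + 4 := by
  induction n using Nat.twoStepInduction with
  | zero =>
    have h := squareCount_add_two 0
    norm_num [Nat.fib_add_two] at h ⊢
    simp [h]
  | one =>
    have h := squareCount_add_two 1
    norm_num [Nat.fib_add_two] at h
    rw [sum_range_succ, sum_range_one]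
    norm_num [Nat.fib_add_two, h, squareCount_zero_three]
  | more n ih1 _ =>
    have h4 : Nat.fib (n + 4) = Nat.fib (n + 2) + Nat.fib (n + 3) := Nat.fib_add_two
    have h5 : Nat.fib (n + 5) = Nat.fib (n + 3) + Nat.fib (n + 4) := Nat.fib_add_two
    have h6 : Nat.fib (n + 6) = Nat.fib (n + 4) + Nat.fib (n + 5) := Nat.fib_add_two
    change (∑ k ∈ range (n + 3), squareCount k (n + 4) : ℚ) =
      (4 * ((n + 2 : ℕ) : ℚ) - 8) / 5 * Nat.fib (n + 6) -
        (2 * ((n + 2 : ℕ) : ℚ) - 2) / 5 * Nat.fib (n + 5) + (n + 2 : ℕ) + 4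
    rw [sum_squareCount_succ_succ, ih1, sum_squareStarts, h6, h5, h4]
    push_cast
    ring

/-- With `f_m = Nat.fib (m + 2)`: for `m ≥ 2`,
`B(f_m) = (4m-16)/5 · f_m − (2m-6)/5 · f_{m-1} + m + 2`. -/
theorem stmt_16 (m : ℕ) (hm : 2 ≤ m) :
    (B (Nat.fib (m + 2)) : ℚ) =
      (4 * (m : ℚ) - 16) / 5 * Nat.fib (m + 2) -
        (2 * (m : ℚ) - 6) / 5 * Nat.fib (m + 1) + m + 2 := by
  obtain ⟨n, rfl⟩ := Nat.exists_eq_add_of_le' hm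
  change (B (Nat.fib (n + 4)) : ℚ) = (4 * ((n + 2 : ℕ) : ℚ) - 16) / 5 * Nat.fib (n + 4) -
    (2 * ((n + 2 : ℕ) : ℚ) - 6) / 5 * Nat.fib (n + 3) + (n + 2 : ℕ) + 2
  rw [B_fib, Nat.cast_sum, sum_squareCount]
  push_cast
  ring
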